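/- Let G=(V,ω) be a connected finite weighted graph and h:V→ℝ with h(x)>0 for all x∈V. Suppose f,g:V×ℝ→ℝ satisfy: (H1) f(x,·) and g(x,·) are continuous, f(x,0)=g(x,0)=0, and f(x,t)≥0, g(x,t)≥0 for all x∈V and t≥0; (H2) there exists s>1 such that f(x,u)/|u|^s→0 and g(x,v)/|v|^s→0 uniformly in x∈V as |u|,|v|→∞; (H3) f(x,u)/|u|→0 and g(x,v)/|v|→0 uniformly in x∈V as |u|,|v|→0; (H4) there exist θ>2 and s₀>0 such that for all s>s₀ and x∈V, θF(x,s)<f(x,s)·s and θG(x,s)<g(x,s)·s, where F(x,s)=∫₀^s f(x,t)dt and G(x,s)=∫₀^s g(x,t)dt. Then there exist u,v:V→ℝ with u(x)>0 and v(x)>0 for all x∈V such that for every x∈V: −Δu(x)+h(x)u(x)=g(x,v(x)) and −Δv(x)+h(x)v(x)=f(x,u(x)). -/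

import Mathlib

noncomputable section

/-- Vertex measure `ψ(x) = Σ_{y∼x} ω(x,y)` (zero weights contribute nothing). -/
def psiW {V : Type*} (w : V → V → ℝ) (x : V) : ℝ := ∑' y, w x y

/-- Integral `∫_V f dψ = Σ_x ψ(x) f(x)`. -/
def intW {V : Type*} (w : V → V → ℝ) (f : V → ℝ) : ℝ := ∑' x, psiW w x * f x

/-- Graph Laplacian `Δu(x) = (1/ψ(x)) Σ_{y∼x} ω(x,y)(u(y)−u(x))`. -/
def lapW {V : Type*} (w : V → V → ℝ) (u : V → ℝ) : V → ℝ := fun x =>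
  (psiW w x)⁻¹ * ∑' y, w x y * (u y - u x)

/-- Gradient form `Γ(u,v)(x)`. -/
def gammaW {V : Type*} (w : V → V → ℝ) (u v : V → ℝ) (x : V) : ℝ :=
  (2 * psiW w x)⁻¹ * ∑' y, w x y * (u y - u x) * (v y - v x)

/-- `|∇u|(x) = Γ(u,u)(x)^{1/2}`. -/
def gradW {V : Type*} (w : V → V → ℝ) (u : V → ℝ) (x : V) : ℝ :=
  Real.sqrt (gammaW w u u x)

/-- `|∇^m u|(x)`: `|∇(Δ^{(m−1)/2}u)|(x)` for odd `m`, `|Δ^{m/2}u(x)|` for even `m`. -/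
def gradmW {V : Type*} (w : V → V → ℝ) (m : ℕ) (u : V → ℝ) (x : V) : ℝ :=
  if m % 2 = 1 then gradW w ((lapW w)^[(m - 1) / 2] u) x
  else |(lapW w)^[m / 2] u x|

/-- The `p`-Laplacian. -/
def plapW {V : Type*} (w : V → V → ℝ) (p : ℝ) (u : V → ℝ) (x : V) : ℝ :=
  (2 * psiW w x)⁻¹ *
    ∑' y, w x y * (gradW w u y ^ (p - 2) + gradW w u x ^ (p - 2)) * (u y - u x)

/-- Connectedness: any two vertices are joined by a chain of adjacent vertices. -/
def ConnW {V : Type*} (w : V → V → ℝ) : Prop :=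
  ∀ x y : V, Relation.ReflTransGen (fun a b => 0 < w a b) x y

/-- Local finiteness: each vertex has finitely many neighbours. -/
def LocFinW {V : Type*} (w : V → V → ℝ) : Prop :=
  ∀ x : V, {y : V | 0 < w x y}.Finite

/-- The first positive eigenvalue `λ₁` of `−Δ`. -/
def lambda1W {V : Type*} (w : V → V → ℝ) : ℝ :=
  sInf { r : ℝ | ∃ u : V → ℝ, u ≠ 0 ∧
    Summable (fun x => psiW w x * u x ^ 2) ∧
    HasSum (fun x => psiW w x * u x) 0 ∧
    r = intW w (fun x => gradW w u x ^ 2) / intW w (fun x => u x ^ 2) }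

/-- `u` is a harmonic eigenfunction of `−Δ` with eigenvalue `λ₁`. -/
def IsEigW {V : Type*} (w : V → V → ℝ) (u : V → ℝ) : Prop :=
  ∀ x : V, -lapW w u x = lambda1W w * u x

/-- Graph distance `ρ(x)` from `x` to `O`: minimal number of edges in a path. -/
def gdistW {V : Type*} (w : V → V → ℝ) (O x : V) : ℕ :=
  sInf { n : ℕ | ∃ f : ℕ → V, f 0 = O ∧ f n = x ∧ ∀ i < n, 0 < w (f i) (f (i + 1)) }

/-- Boundary `∂Ω` of a domain `Ω`. -/
def bdryW {V : Type*} (w : V → V → ℝ) (Ω : Set V) : Set V :=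
  {x ∈ Ω | ∃ y, y ∉ Ω ∧ 0 < w x y}

/-- Interior `Ω° = Ω ∖ ∂Ω`. -/
def intrW {V : Type*} (w : V → V → ℝ) (Ω : Set V) : Set V := Ω \ bdryW w Ω

/-- `W_0^{m,p}(Ω)` (the underlying set depends only on `m`):
functions vanishing off `Ω` whose gradients of order `< m` vanish on `∂Ω`. -/
def W0 {V : Type*} (w : V → V → ℝ) (Ω : Set V) (m : ℕ) : Set (V → ℝ) :=
  {u | (∀ x, x ∉ Ω → u x = 0) ∧ ∀ x ∈ bdryW w Ω, ∀ i < m, gradmW w i u x = 0}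

/-- The bilinear form `B_m(u,φ)` appearing in the weak formulation of `𝓛_{m,p}`. -/
def BformW {V : Type*} (w : V → V → ℝ) (m : ℕ) (u φ : V → ℝ) (x : V) : ℝ :=
  if m % 2 = 1 then
    gammaW w ((lapW w)^[(m - 1) / 2] u) ((lapW w)^[(m - 1) / 2] φ) x
  else (lapW w)^[m / 2] u x * (lapW w)^[m / 2] φ x

/-- Iterated operator `(−Δ)^m`. -/
def nlapIterW {V : Type*} (w : V → V → ℝ) (m : ℕ) (u : V → ℝ) : V → ℝ :=
  (fun f x => -lapW w f x)^[m] u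

section Auxiliary

open Set Metric Filter MeasureTheory Topology

/-- Lagrange extrapolation to `1` of a polynomial of degree at most `n` from `n + 1` nodes. -/
theorem Polynomial.eval_one_eq_sum_lagrange {n : ℕ} {v : Fin (n + 1) → ℝ}
    (hv : Function.Injective v) {p : Polynomial ℝ} (hp : p.natDegree ≤ n) :
    p.eval 1 = ∑ i, p.eval (v i) * (Lagrange.basis Finset.univ v i).eval 1 := by
  have hdeg : p.degree < (Finset.univ : Finset (Fin (n + 1))).card := by
    rw [Finset.card_univ, Fintype.card_fin]
    exact Polynomial.degree_le_natDegree.trans_lt (by exact_mod_cast Nat.lt_succ_of_le hp)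
  have h := Lagrange.eq_interpolate (s := Finset.univ) hv.injOn hdeg
  conv_lhs => rw [h]
  simp [Lagrange.interpolate_apply, Polynomial.eval_finsetSum]

theorem exists_pos_det_pos_of_norm_sub_one_lt {E : Type*} [NormedAddCommGroup E]
    [NormedSpace ℝ E] :
    ∃ δ > 0, ∀ A : E →L[ℝ] E, ‖A - 1‖ < δ → 0 < A.det := by
  have hc : Continuous fun A : E →L[ℝ] E => A.det := ContinuousLinearMap.continuous_det
  have h1 : (1 : E →L[ℝ] E).det = 1 := by
    change LinearMap.det (LinearMap.id : E →ₗ[ℝ] E) = 1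
    simp
  have : ∀ᶠ A in 𝓝 (1 : E →L[ℝ] E), 0 < A.det :=
    hc.continuousAt.eventually (lt_mem_nhds (by simp only [h1]; exact one_pos))
  obtain ⟨δ, hδ, h⟩ := Metric.eventually_nhds_iff.mp this
  exact ⟨δ, hδ, fun A hA => h (by rwa [dist_eq_norm])⟩

section FiniteDimensional

variable {E : Type*} [NormedAddCommGroup E] [NormedSpace ℝ E] [FiniteDimensional ℝ E]

theorem exists_polynomial_eval_eq_det_one_add_smul (A : E →L[ℝ] E) :
    ∃ p : Polynomial ℝ, p.natDegree ≤ Module.finrank ℝ E ∧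
      ∀ t : ℝ, p.eval t = (1 + t • A).det := by
  classical
  let b := Module.finBasis ℝ E
  let M := LinearMap.toMatrix b b (A : E →ₗ[ℝ] E)
  refine ⟨Matrix.det ((Polynomial.X : Polynomial ℝ) • M.map Polynomial.C +
    (1 : Matrix _ _ ℝ).map Polynomial.C), ?_, fun t => ?_⟩
  · simpa using Polynomial.natDegree_det_X_add_C_le M 1
  · rw [ContinuousLinearMap.det, ← LinearMap.det_toMatrix b, ← Polynomial.coe_evalRingHom,
      RingHom.map_det]
    congr 1
    have h1 : LinearMap.toMatrix b b ((1 + t • A : E →L[ℝ] E) : E →ₗ[ℝ] E) = 1 + t • M := by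
      have : ((1 + t • A : E →L[ℝ] E) : E →ₗ[ℝ] E) = LinearMap.id + t • (A : E →ₗ[ℝ] E) := rfl
      rw [this, map_add, map_smul, LinearMap.toMatrix_id]
    rw [h1]
    ext i j
    simp [Matrix.one_apply, apply_ite, add_comm]
    exact mul_comm _ _

theorem exists_contDiff_dist_lt_of_isCompact {F : Type*} [NormedAddCommGroup F]
    [NormedSpace ℝ F] [CompleteSpace F] {f : E → F} (hf : Continuous f) {K : Set E}
    (hK : IsCompact K) {ε : ℝ} (hε : 0 < ε) :
    ∃ g : E → F, ContDiff ℝ 1 g ∧ ∀ x ∈ K, dist (g x) (f x) < ε := by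
  have : UniformContinuousOn f (cthickening 1 K) :=
    hK.cthickening.uniformContinuousOn_of_continuous hf.continuousOn
  obtain ⟨δ, hδ, hfδ⟩ := Metric.uniformContinuousOn_iff.mp this (ε / 2) (half_pos hε)
  obtain ⟨g, hgc, hg⟩ :=
    hf.exists_contDiff_dist_le_of_forall_mem_ball_dist_le (lt_min one_pos hδ)
  refine ⟨g, hgc.of_le (by simp), fun x hx => (hg _ _ fun y hy => ?_).trans_lt (half_lt_self hε)⟩
  rw [mem_ball, lt_min_iff] at hy
  exact (hfδ _ (mem_cthickening_of_dist_le _ x _ _ hx hy.1.le) _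
    (self_subset_cthickening _ hx) hy.2).le

/-- If a continuously differentiable perturbation of the identity keeps an open ball inside
itself, fixes its sphere, and is locally invertible, then it maps the ball onto itself. -/
theorem image_ball_eq_ball_of_det_ne_zero {ρ : ℝ} (hρ : 0 < ρ) {φ : E → E}
    (hφ : ContDiff ℝ 1 φ) (hdet : ∀ x ∈ ball (0 : E) ρ, (fderiv ℝ φ x).det ≠ 0)
    (hball : MapsTo φ (ball 0 ρ) (ball 0 ρ)) (hsphere : ∀ x, ‖x‖ = ρ → φ x = x) :
    φ '' ball 0 ρ = ball 0 ρ := by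
  refine (image_subset_iff.mpr hball).antisymm ?_
  have hopen : IsOpen (φ '' ball 0 ρ) := by
    rw [isOpen_iff_mem_nhds]
    rintro _ ⟨x, hx, rfl⟩
    have hs : HasStrictFDerivAt φ
        (((fderiv ℝ φ x).toContinuousLinearEquivOfDetNeZero (hdet x hx) : E ≃L[ℝ] E) :
          E →L[ℝ] E) x := by
      rw [ContinuousLinearMap.coe_toContinuousLinearEquivOfDetNeZero]
      exact hφ.contDiffAt.hasStrictFDerivAt (by simp)
    rw [← hs.map_nhds_eq_of_equiv]
    exact image_mem_map (isOpen_ball.mem_nhds hx)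
  refine (convex_ball (0 : E) ρ).isPreconnected.subset_of_closure_inter_subset hopen ?_ ?_
  · exact ⟨φ 0, hball (mem_ball_self hρ), mem_image_of_mem _ (mem_ball_self hρ)⟩
  · rintro y ⟨hy, hyb⟩
    have hcl : closure (φ '' ball 0 ρ) ⊆ φ '' closedBall 0 ρ :=
      closure_minimal (image_mono ball_subset_closedBall)
        ((isCompact_closedBall 0 ρ).image hφ.continuous).isClosed
    obtain ⟨x, hx, rfl⟩ := hcl hy
    rcases (mem_closedBall_zero_iff.mp hx).lt_or_eq with h | h
    · exact mem_image_of_mem _ (mem_ball_zero_iff.mpr h)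
    · rw [hsphere x h, mem_ball_zero_iff] at hyb
      exact absurd h hyb.ne

end FiniteDimensional

section InnerProduct

variable {E : Type*} [NormedAddCommGroup E] [InnerProductSpace ℝ E] [FiniteDimensional ℝ E]

theorem det_fderiv_eq_zero_of_norm_eq {r : E → E} (hr : ContDiff ℝ 1 r) {ρ : ℝ} (hρ : 0 < ρ)
    (hnorm : ∀ x, ‖r x‖ = ρ) (x : E) : (fderiv ℝ r x).det = 0 := by
  by_contra hdet
  have hd : HasFDerivAt r (fderiv ℝ r x) x :=
    (hr.differentiable (by simp) x).hasFDerivAt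
  let e := (fderiv ℝ r x).toContinuousLinearEquivOfDetNeZero hdet
  have h1 := hd.norm_sq
  have h2 : HasFDerivAt (fun y => ‖r y‖ ^ 2) (0 : E →L[ℝ] ℝ) x := by
    simp only [hnorm]
    exact hasFDerivAt_const _ _
  have h3 := congrArg (fun L : E →L[ℝ] ℝ => L (e.symm (r x))) (h1.unique h2)
  have h4 : fderiv ℝ r x (e.symm (r x)) = r x := e.apply_symm_apply (r x)
  simp [h4, hnorm] at h3
  exact hρ.ne' h3

/-- There is no continuously differentiable retraction of a closed ball onto its sphere. -/
theorem not_exists_contDiff_retraction_sphere {ρ : ℝ} (hρ : 0 < ρ) {r : E → E}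
    (hr : ContDiff ℝ 1 r) (hnorm : ∀ x, ‖r x‖ = ρ) (hfix : ∀ x, ‖x‖ = ρ → r x = x) : False := by
  borelize E
  let A : E → E →L[ℝ] E := fun x => fderiv ℝ r x - 1
  have hAc : Continuous A := (hr.continuous_fderiv (by simp)).sub continuous_const
  have hrd : Differentiable ℝ r := hr.differentiable (by simp)
  obtain ⟨C, hC⟩ := (isCompact_closedBall (0 : E) ρ).exists_bound_of_continuousOn hAc.continuousOn
  have hC0 : 0 ≤ C := (norm_nonneg _).trans (hC 0 (mem_closedBall_self hρ.le))
  obtain ⟨δ, hδ, hdet⟩ := exists_pos_det_pos_of_norm_sub_one_lt (E := E)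
  let μ : Measure E := Measure.addHaar
  let φ : ℝ → E → E := fun t x => x + t • (r x - x)
  have hφd : ∀ t x, HasFDerivAt (φ t) (1 + t • A x) x := fun t x =>
    (hasFDerivAt_id x).add (((hrd x).hasFDerivAt.sub (hasFDerivAt_id x)).const_smul t)
  have hφc : ∀ t, ContDiff ℝ 1 (φ t) := fun t => contDiff_id.add ((hr.sub contDiff_id).const_smul t)
  have hDc : ∀ t : ℝ, Continuous fun x => (1 + t • A x).det := fun t =>
    ContinuousLinearMap.continuous_det.comp (continuous_const.add (hAc.const_smul t))
  have hint : ∀ t : ℝ, IntegrableOn (fun x => (1 + t • A x).det) (ball 0 ρ) μ := fun t =>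
    ((hDc t).continuousOn.integrableOn_compact (isCompact_closedBall 0 ρ)).mono_set
      ball_subset_closedBall
  obtain ⟨T, hT0, hT1, hTC, hTδ⟩ : ∃ T : ℝ, 0 < T ∧ T < 1 ∧ T * C < 1 ∧ T * C < δ := by
    refine ⟨min 1 δ / (C + 2), by positivity, ?_, ?_, ?_⟩
    · rw [div_lt_one (by positivity)]
      linarith [min_le_left 1 δ]
    all_goals
      rw [div_mul_eq_mul_div, div_lt_iff₀ (by positivity)]
      nlinarith [min_le_left 1 δ, min_le_right 1 δ, lt_min one_pos hδ]
  have hsmall : ∀ t : ℝ, 0 < t → t ≤ T →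
      ∫ x in ball 0 ρ, (1 + t • A x).det ∂μ = μ.real (ball 0 ρ) := by
    intro t ht0 htT
    have htC : t * C ≤ T * C := mul_le_mul_of_nonneg_right htT hC0
    have hpos : ∀ x ∈ ball (0 : E) ρ, 0 < (1 + t • A x).det := by
      intro x hx
      refine hdet _ ?_
      rw [add_sub_cancel_left, norm_smul, Real.norm_of_nonneg ht0.le]
      exact ((mul_le_mul_of_nonneg_left (hC x (ball_subset_closedBall hx)) ht0.le).trans
        htC).trans_lt hTδ
    have hinj : InjOn (φ t) (ball 0 ρ) := by
      intro x hx y hy hxy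
      have hlip := (convex_closedBall (0 : E) ρ).norm_image_sub_le_of_norm_hasFDerivWithin_le
        (f := fun x => r x - x) (f' := A)
        (fun z _ => ((hrd z).hasFDerivAt.sub (hasFDerivAt_id z)).hasFDerivWithinAt) hC
        (ball_subset_closedBall hx) (ball_subset_closedBall hy)
      have heq : x - y = t • ((r y - y) - (r x - x)) := by
        have : x + t • (r x - x) = y + t • (r y - y) := hxy
        rw [smul_sub, sub_eq_sub_iff_add_eq_add, this, add_comm]
      have hle : ‖x - y‖ ≤ t * C * ‖x - y‖ := by
        calc ‖x - y‖ = t * ‖(r y - y) - (r x - x)‖ := by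
              rw [heq, norm_smul, Real.norm_of_nonneg ht0.le]
          _ ≤ t * (C * ‖y - x‖) := mul_le_mul_of_nonneg_left hlip ht0.le
          _ = t * C * ‖x - y‖ := by rw [norm_sub_rev, mul_assoc]
      have : ‖x - y‖ = 0 := by nlinarith [norm_nonneg (x - y)]
      exact sub_eq_zero.mp (norm_eq_zero.mp this)
    have himage : φ t '' ball 0 ρ = ball 0 ρ := by
      refine image_ball_eq_ball_of_det_ne_zero hρ (hφc t) (fun x hx => ?_) (fun x hx => ?_)
        fun x hx => ?_
      · rw [(hφd t x).fderiv]
        exact (hpos x hx).ne'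
      · rw [mem_ball_zero_iff] at hx ⊢
        have : φ t x = (1 - t) • x + t • r x := by
          simp only [φ]; module
        calc ‖φ t x‖ ≤ (1 - t) * ‖x‖ + t * ‖r x‖ := by
              rw [this]
              refine (norm_add_le _ _).trans_eq ?_
              rw [norm_smul, norm_smul, Real.norm_of_nonneg ht0.le,
                Real.norm_of_nonneg (by linarith)]
          _ < ρ := by
              rw [hnorm]
              nlinarith
      · simp [φ, hfix x hx]
    have key := lintegral_abs_det_fderiv_eq_addHaar_image μ measurableSet_ball
      (fun x _ => (hφd t x).hasFDerivWithinAt) hinj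
    rw [himage] at key
    rw [integral_eq_lintegral_of_nonneg_ae
      ((ae_restrict_mem measurableSet_ball).mono fun x hx => (hpos x hx).le)
      (hint t).aestronglyMeasurable, measureReal_def, ← key]
    congr 1
    exact setLIntegral_congr_fun measurableSet_ball fun x hx => by
      simp only [abs_of_pos (hpos x hx)]
  let n := Module.finrank ℝ E
  let v : Fin (n + 1) → ℝ := fun i => T / (i + 1)
  have hv : Function.Injective v := by
    intro i j hij
    have hij' : T / ((i : ℝ) + 1) = T / ((j : ℝ) + 1) := hij
    rw [div_eq_div_iff (by positivity) (by positivity), mul_right_inj' hT0.ne', add_left_inj,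
      Nat.cast_inj] at hij'
    exact Fin.ext hij'.symm
  let c : Fin (n + 1) → ℝ := fun i => (Lagrange.basis Finset.univ v i).eval 1
  have hsum : ∑ i, c i = 1 := by
    simpa using (Polynomial.eval_one_eq_sum_lagrange hv (p := 1) (by simp)).symm
  have hexp : ∀ x, (1 + (1 : ℝ) • A x).det = ∑ i, (1 + v i • A x).det * c i := by
    intro x
    obtain ⟨p, hp, hpe⟩ := exists_polynomial_eval_eq_det_one_add_smul (A x)
    have h := Polynomial.eval_one_eq_sum_lagrange hv hp
    simpa only [hpe] using h
  have htotal : ∫ x in ball 0 ρ, (1 + (1 : ℝ) • A x).det ∂μ = μ.real (ball 0 ρ) := by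
    simp only [hexp]
    rw [integral_finsetSum _ fun i _ => (hint (v i)).mul_const _]
    calc ∑ i, ∫ x in ball 0 ρ, (1 + v i • A x).det * c i ∂μ
        = ∑ i, μ.real (ball 0 ρ) * c i := by
          refine Finset.sum_congr rfl fun i _ => ?_
          rw [integral_mul_const, hsmall (v i) (by positivity)
            (div_le_self hT0.le (by linarith [Nat.cast_nonneg (α := ℝ) (i : ℕ)]))]
      _ = μ.real (ball 0 ρ) := by rw [← Finset.mul_sum, hsum, mul_one]
  have hzero : ∫ x in ball 0 ρ, (1 + (1 : ℝ) • A x).det ∂μ = 0 := by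
    simp [A, det_fderiv_eq_zero_of_norm_eq hr hρ hnorm]
  have hvol : 0 < μ.real (ball 0 ρ) :=
    ENNReal.toReal_pos (measure_ball_pos μ 0 hρ).ne' measure_ball_lt_top.ne
  rw [← htotal, hzero] at hvol
  exact hvol.false

/-- **Brouwer's fixed point theorem** for bounded continuous self-maps. -/
theorem exists_fixedPoint_of_norm_le {Ψ : E → E} (hΨ : Continuous Ψ) {C : ℝ}
    (hC : ∀ x, ‖Ψ x‖ ≤ C) : ∃ x, Ψ x = x := by
  by_contra! hne
  have hC0 : 0 ≤ C := (norm_nonneg _).trans (hC 0)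
  set R := C + 1 with hR
  have hR0 : 0 < R := by positivity
  have hK := isCompact_closedBall (0 : E) (2 * R)
  obtain ⟨x₀, -, hx₀⟩ := hK.exists_isMinOn ⟨0, mem_closedBall_self (by positivity)⟩
    (hΨ.sub continuous_id).norm.continuousOn
  have hm : 0 < ‖Ψ x₀ - x₀‖ := norm_pos_iff.mpr (sub_ne_zero.mpr (hne x₀))
  obtain ⟨g, hg, hgΨ⟩ := exists_contDiff_dist_lt_of_isCompact hΨ hK (lt_min hm one_pos)
  let χ : ContDiffBump (0 : E) := ⟨R, 2 * R, hR0, by linarith⟩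
  let F : E → E := fun x => x - χ x • g x
  have hFc : ContDiff ℝ 1 F := contDiff_id.sub (χ.contDiff.smul hg)
  have hout : ∀ x, 2 * R ≤ ‖x‖ → F x = x := by
    intro x hx
    have : χ x = 0 := χ.zero_of_le_dist (by simpa using hx)
    simp [F, this]
  have hF0 : ∀ x, F x ≠ 0 := by
    intro x hx
    rcases le_or_gt (2 * R) ‖x‖ with h2 | h2
    · rw [hout x h2] at hx
      rw [hx, norm_zero] at h2
      linarith
    have hxK : x ∈ closedBall (0 : E) (2 * R) := mem_closedBall_zero_iff.mpr h2.le
    have hclose := hgΨ x hxK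
    rw [dist_eq_norm, lt_min_iff] at hclose
    have hxeq : x = χ x • g x := sub_eq_zero.mp hx
    rcases le_or_gt ‖x‖ R with h1 | h1
    · have : χ x = 1 := χ.one_of_mem_closedBall (mem_closedBall_zero_iff.mpr h1)
      rw [this, one_smul] at hxeq
      have hmin : ‖Ψ x₀ - x₀‖ ≤ ‖Ψ x - x‖ := hx₀ hxK
      rw [← hxeq, norm_sub_rev] at hclose
      linarith [hclose.1]
    · have hgn : ‖g x‖ < R := by
        have := norm_le_norm_add_norm_sub (Ψ x) (g x)
        rw [norm_sub_rev] at this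
        linarith [hC x, hclose.2]
      have : ‖x‖ ≤ ‖g x‖ := by
        conv_lhs => rw [hxeq, norm_smul, Real.norm_of_nonneg χ.nonneg]
        exact mul_le_of_le_one_left (norm_nonneg _) χ.le_one
      linarith
  refine not_exists_contDiff_retraction_sphere (E := E) (ρ := 2 * R) (by positivity)
    (r := fun x => (2 * R * ‖F x‖⁻¹) • F x) ?_ ?_ ?_
  · exact ((contDiff_const.mul ((hFc.norm ℝ hF0).inv fun x => norm_ne_zero_iff.mpr (hF0 x)))).smul
      hFc
  · intro x
    have := norm_ne_zero_iff.mpr (hF0 x)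
    rw [norm_smul, Real.norm_of_nonneg (by positivity)]
    field_simp
  · intro x hx
    simp only [hout x hx.ge, hx]
    rw [mul_inv_cancel₀ (by positivity), one_smul]

end InnerProduct

/-- Brouwer's fixed point theorem for bounded continuous self-maps of `ι → ℝ`. -/
theorem exists_fixedPoint_pi_of_norm_le {ι : Type*} [Fintype ι] {Ψ : (ι → ℝ) → ι → ℝ}
    (hΨ : Continuous Ψ) {C : ℝ} (hC : ∀ x, ‖Ψ x‖ ≤ C) : ∃ x, Ψ x = x := by
  let e := EuclideanSpace.equiv ι ℝ
  obtain ⟨x, hx⟩ := exists_fixedPoint_of_norm_le (Ψ := fun x => e.symm (Ψ (e x)))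
    (by fun_prop) (C := ‖(e.symm : (ι → ℝ) →L[ℝ] EuclideanSpace ℝ ι)‖ * C) fun x =>
      ((e.symm : (ι → ℝ) →L[ℝ] EuclideanSpace ℝ ι).le_opNorm _).trans
        (mul_le_mul_of_nonneg_left (hC _) (norm_nonneg _))
  exact ⟨e x, by simpa using congrArg e hx⟩

section Cone

variable {V : Type*} [Fintype V]

theorem exists_apply_eq_norm_of_nonneg [Nonempty V] {u : V → ℝ} (hu : 0 ≤ u) :
    ∃ y, u y = ‖u‖ := by
  obtain ⟨y, hy⟩ := Finite.exists_max u
  refine ⟨y, le_antisymm ((le_abs_self _).trans (norm_le_pi_norm u y)) ?_⟩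
  refine (pi_norm_le_iff_of_nonneg (hu y)).mpr fun x => ?_
  rw [Real.norm_of_nonneg (hu x)]
  exact hy x

theorem exists_eq_add_const_of_cone_expansion [Nonempty V] {T : (V → ℝ) → V → ℝ}
    (hT : Continuous T) (hT0 : ∀ u, 0 ≤ u → 0 ≤ T u) {r R ε : ℝ} (hr : 0 < r) (hrR : r < R)
    (hsmall : ∀ u, 0 ≤ u → ‖u‖ = r → ‖T u‖ ≤ r / 2)
    (hlarge : ∀ u, 0 ≤ u → ‖u‖ = R → R < ‖T u‖) (hε : 0 < ε) (hεr : ε < r / 2) :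
    ∃ u, 0 ≤ u ∧ r ≤ ‖u‖ ∧ ‖u‖ ≤ R ∧ u = T u + fun _ => ε := by
  let T' : (V → ℝ) → V → ℝ := fun u => T (u ⊔ 0) + fun _ => ε
  have hposc : Continuous fun u : V → ℝ => u ⊔ 0 :=
    continuous_pi fun x => (continuous_apply x).sup continuous_const
  have hT'c : Continuous T' :=
    (hT.comp hposc).add continuous_const
  have hT'x : ∀ u x, ε ≤ T' u x := fun u x =>
    le_add_of_nonneg_left (hT0 _ le_sup_right x)
  have hT'n : ∀ u, 0 < ‖T' u‖ := fun u =>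
    let x := Classical.arbitrary V
    hε.trans_le (((hT'x u x).trans (le_abs_self _)).trans (norm_le_pi_norm (T' u) x))
  let φ : (V → ℝ) → ℝ := fun u => max r (min R (2 * ‖u ⊔ 0‖ - ‖T' u‖))
  have hφc : Continuous φ := continuous_const.max (continuous_const.min
    ((continuous_const.mul hposc.norm).sub hT'c.norm))
  have hφr : ∀ u, r ≤ φ u := fun u => le_max_left _ _
  have hφR : ∀ u, φ u ≤ R := fun u => max_le hrR.le (min_le_left _ _)
  let Ψ : (V → ℝ) → V → ℝ := fun u => (φ u * ‖T' u‖⁻¹) • T' u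
  have hΨn : ∀ u, ‖Ψ u‖ = φ u := fun u => by
    have h1 := hT'n u
    have h2 := hr.trans_le (hφr u)
    rw [norm_smul, Real.norm_of_nonneg (by positivity)]
    field_simp
  have hΨc : Continuous Ψ :=
    (hφc.mul (hT'c.norm.inv₀ fun u => (hT'n u).ne')).smul hT'c
  obtain ⟨u, hu⟩ := exists_fixedPoint_pi_of_norm_le hΨc (C := R)
    fun u => (hΨn u).trans_le (hφR u)
  have hun : ‖u‖ = φ u := by rw [← hΨn u, hu]
  have hu0 : 0 ≤ u := by
    rw [← hu]
    exact smul_nonneg (mul_nonneg (hr.le.trans (hφr u)) (inv_nonneg.mpr (norm_nonneg _)))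
      fun x => hε.le.trans (hT'x u x)
  have hsup : u ⊔ 0 = u := sup_eq_left.mpr hu0
  have hT'u : T' u = T u + fun _ => ε := by simp only [T', hsup]
  have hnorm : ‖T' u‖ = ‖u‖ := by
    have hφu : ‖u‖ = max r (min R (2 * ‖u‖ - ‖T' u‖)) := by
      conv_lhs => rw [hun]
      simp only [φ, hsup]
    by_contra hne
    have hcases : ‖u‖ = r ∧ r ≤ ‖T' u‖ ∨ ‖u‖ = R ∧ ‖T' u‖ ≤ R := by
      grind
    rcases hcases with ⟨h1, h2⟩ | ⟨h1, h2⟩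
    · have h3 := hsmall u hu0 h1
      have h4 : ‖T' u‖ ≤ ‖T u‖ + ε := by
        rw [hT'u]
        refine (norm_add_le _ _).trans_eq ?_
        rw [pi_norm_const, Real.norm_of_nonneg hε.le]
      linarith
    · have h3 := hlarge u hu0 h1
      have h4 : ‖T u‖ ≤ ‖T' u‖ := by
        refine (pi_norm_le_iff_of_nonneg (norm_nonneg _)).mpr fun x => ?_
        rw [Real.norm_of_nonneg (hT0 u hu0 x)]
        refine le_trans ?_ ((le_abs_self _).trans (norm_le_pi_norm (T' u) x))
        rw [hT'u]
        exact le_add_of_nonneg_right hε.le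
      linarith
  refine ⟨u, hu0, hun ▸ hφr u, hun ▸ hφR u, ?_⟩
  have h1 : (φ u * ‖T' u‖⁻¹) • T' u = u := hu
  rw [hnorm, ← hun, mul_inv_cancel₀ (hnorm ▸ (hT'n u).ne'), one_smul, hT'u] at h1
  exact h1.symm

/-- Cone expansion fixed point theorem (Krasnoselskii) on the nonnegative orthant. -/
theorem exists_fixedPoint_of_cone_expansion [Nonempty V] {T : (V → ℝ) → V → ℝ}
    (hT : Continuous T) (hT0 : ∀ u, 0 ≤ u → 0 ≤ T u) {r R : ℝ} (hr : 0 < r) (hrR : r < R)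
    (hsmall : ∀ u, 0 ≤ u → ‖u‖ = r → ‖T u‖ ≤ r / 2)
    (hlarge : ∀ u, 0 ≤ u → ‖u‖ = R → R < ‖T u‖) :
    ∃ u, 0 ≤ u ∧ u ≠ 0 ∧ T u = u := by
  have hex := fun ε => exists_eq_add_const_of_cone_expansion (ε := ε) hT hT0 hr hrR hsmall hlarge
  let K : Set (V → ℝ) := closedBall 0 R ∩ {u | 0 ≤ u ∧ r ≤ ‖u‖}
  have hK : IsCompact K := (isCompact_closedBall 0 R).inter_right
    ((isClosed_le continuous_const continuous_id).inter
      (isClosed_le continuous_const continuous_norm))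
  obtain ⟨u₁, h1, h2, h3, -⟩ := hex (r / 4) (by positivity) (by linarith)
  obtain ⟨u, ⟨-, hu0, hur⟩, hmin⟩ := hK.exists_isMinOn
    ⟨u₁, mem_closedBall_zero_iff.mpr h3, h1, h2⟩ (hT.sub continuous_id).norm.continuousOn
  refine ⟨u, hu0, norm_pos_iff.mp (hr.trans_le hur), ?_⟩
  by_contra hne
  have hm : 0 < ‖T u - u‖ := norm_pos_iff.mpr (sub_ne_zero.mpr hne)
  obtain ⟨u₂, h1, h2, h3, h4⟩ := hex (min (‖T u - u‖ / 2) (r / 4)) (by positivity)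
    ((min_le_right _ _).trans_lt (by linarith))
  have hle : ‖T u - u‖ ≤ ‖T u₂ - u₂‖ := hmin ⟨mem_closedBall_zero_iff.mpr h3, h1, h2⟩
  have heq : ‖T u₂ - u₂‖ = min (‖T u - u‖ / 2) (r / 4) := by
    conv_lhs => rw [norm_sub_rev, sub_eq_of_eq_add' h4]
    rw [pi_norm_const, Real.norm_of_nonneg (by positivity)]
  linarith [min_le_left (‖T u - u‖ / 2) (r / 4)]

/-- A positive solution of a superlinear Hammerstein system with a strictly positive kernel. -/
theorem exists_pos_solution_hammerstein_system [Nonempty V] (S : (V → ℝ) →ₗ[ℝ] V → ℝ) {c : ℝ}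
    (hc : 0 < c) (hS : ∀ k, 0 ≤ k → ∀ x y, c * k y ≤ S k x) {f g : V → ℝ → ℝ}
    (hf : ∀ x, Continuous (f x)) (hg : ∀ x, Continuous (g x)) (hg0 : ∀ x, g x 0 = 0)
    (hfnn : ∀ x t, 0 ≤ t → 0 ≤ f x t) (hgnn : ∀ x t, 0 ≤ t → 0 ≤ g x t)
    (hzero : ∀ ε > 0, ∃ δ > 0, ∀ x, ∀ t : ℝ, |t| ≤ δ → |f x t| ≤ ε * |t| ∧ |g x t| ≤ ε * |t|)
    (hf_top : ∀ M : ℝ, ∀ x, ∀ᶠ t in atTop, M * t ≤ f x t)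
    (hg_top : ∀ M : ℝ, ∀ x, ∀ᶠ t in atTop, M * t ≤ g x t) :
    ∃ u v : V → ℝ, (∀ x, 0 < u x ∧ 0 < v x) ∧
      u = S (fun x => g x (v x)) ∧ v = S (fun x => f x (u x)) := by
  have hSc : Continuous S := S.continuous_of_finiteDimensional
  have hSnn : ∀ k, 0 ≤ k → 0 ≤ S k := fun k hk x =>
    (mul_nonneg hc.le (hk x)).trans (hS k hk x x)
  obtain ⟨C, hC, hCS⟩ := (LinearMap.toContinuousLinearMap S).bound
  replace hCS : ∀ k, ‖S k‖ ≤ C * ‖k‖ := hCS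
  let A : (V → ℝ) → V → ℝ := fun u => S fun x => f x (u x)
  let B : (V → ℝ) → V → ℝ := fun v => S fun x => g x (v x)
  have hAc : Continuous A :=
    hSc.comp (continuous_pi fun x => (hf x).comp (continuous_apply x))
  have hBc : Continuous B :=
    hSc.comp (continuous_pi fun x => (hg x).comp (continuous_apply x))
  have hA0 : ∀ u, 0 ≤ u → 0 ≤ A u := fun u hu => hSnn _ fun x => hfnn x _ (hu x)
  have hB0 : ∀ v, 0 ≤ v → 0 ≤ B v := fun v hv => hSnn _ fun x => hgnn x _ (hv x)
  obtain ⟨r, hr, hfr⟩ := hzero (1 / (2 * C)) (by positivity)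
  have hcontr : ∀ k : V → ℝ → ℝ, (∀ x, ∀ t : ℝ, |t| ≤ r → |k x t| ≤ 1 / (2 * C) * |t|) →
      ∀ u : V → ℝ, ‖u‖ ≤ r → ‖S fun x => k x (u x)‖ ≤ ‖u‖ / 2 := by
    intro k hk u hu
    have h1 : ‖fun x => k x (u x)‖ ≤ 1 / (2 * C) * ‖u‖ := by
      refine (pi_norm_le_iff_of_nonneg (by positivity)).mpr fun x => ?_
      have hux : |u x| ≤ ‖u‖ := norm_le_pi_norm u x
      exact (hk x _ (hux.trans hu)).trans (mul_le_mul_of_nonneg_left hux (by positivity))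
    calc ‖S fun x => k x (u x)‖ ≤ C * (1 / (2 * C) * ‖u‖) :=
          (hCS _).trans (mul_le_mul_of_nonneg_left h1 hC.le)
      _ = ‖u‖ / 2 := by field_simp
  obtain ⟨N, hN⟩ := eventually_atTop.mp
    ((eventually_all.mpr (hf_top (2 / c))).and (eventually_all.mpr (hg_top (2 / c))))
  set R := max N (r + 1)
  have hrR : r < R := (lt_add_one r).trans_le (le_max_right _ _)
  have hgrow : ∀ k : V → ℝ → ℝ, (∀ x t, 0 ≤ t → 0 ≤ k x t) →
      (∀ x t, R ≤ t → 2 / c * t ≤ k x t) → ∀ u : V → ℝ, 0 ≤ u → R ≤ ‖u‖ →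
      ∀ x, 2 * ‖u‖ ≤ S (fun y => k y (u y)) x := by
    intro k hk0 hk u hu huR x
    obtain ⟨y, hy⟩ := exists_apply_eq_norm_of_nonneg hu
    calc 2 * ‖u‖ = c * (2 / c * u y) := by rw [hy]; field_simp
      _ ≤ c * k y (u y) := mul_le_mul_of_nonneg_left (hk y _ (huR.trans_eq hy.symm)) hc.le
      _ ≤ _ := hS _ (fun z => hk0 z _ (hu z)) x y
  have hgrow_norm : ∀ k : V → ℝ → ℝ, (∀ x t, 0 ≤ t → 0 ≤ k x t) →
      (∀ x t, R ≤ t → 2 / c * t ≤ k x t) → ∀ u : V → ℝ, 0 ≤ u → R ≤ ‖u‖ →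
      2 * ‖u‖ ≤ ‖S (fun y => k y (u y))‖ := fun k hk0 hk u hu huR =>
    let x := Classical.arbitrary V
    ((hgrow k hk0 hk u hu huR x).trans (le_abs_self _)).trans
      (norm_le_pi_norm (S (fun y => k y (u y))) x)
  have hNR : N ≤ R := le_max_left _ _
  obtain ⟨u, hu0, hune, hu⟩ := exists_fixedPoint_of_cone_expansion (T := fun u => B (A u))
    (hBc.comp hAc) (fun u hu => hB0 _ (hA0 u hu)) hr hrR
    (fun u hu hur => by
      have h1 : ‖A u‖ ≤ ‖u‖ / 2 := hcontr f (fun x t ht => (hfr x t ht).1) u hur.le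
      have h2 : ‖B (A u)‖ ≤ ‖A u‖ / 2 :=
        hcontr g (fun x t ht => (hfr x t ht).2) (A u) (by linarith)
      linarith)
    (fun u hu huR => by
      have h1 : 2 * ‖u‖ ≤ ‖A u‖ :=
        hgrow_norm f hfnn (fun x t ht => (hN t (hNR.trans ht)).1 x) u hu huR.ge
      have h2 : 2 * ‖A u‖ ≤ ‖B (A u)‖ :=
        hgrow_norm g hgnn (fun x t ht => (hN t (hNR.trans ht)).2 x) (A u) (hA0 u hu)
          (by linarith)
      linarith)
  have hpos : ∀ k : V → ℝ, 0 ≤ k → S k ≠ 0 → ∀ x, 0 < S k x := by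
    intro k hk hne x
    obtain ⟨y, hy⟩ : ∃ y, k y ≠ 0 := by
      by_contra! h
      exact hne (by rw [show k = 0 from funext h, map_zero])
    exact (mul_pos hc ((hk y).lt_of_ne' hy)).trans_le (hS k hk x y)
  have hAu : A u ≠ 0 := by
    intro h
    have : B (A u) = 0 := by
      rw [h]
      simp only [B, Pi.zero_apply, hg0]
      exact map_zero S
    exact hune (hu.symm.trans this)
  refine ⟨u, A u, fun x => ⟨?_, ?_⟩, hu.symm, rfl⟩
  · have h1 := hpos (fun x => g x (A u x)) (fun x => hgnn x _ (hA0 u hu0 x))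
      (hu.trans_ne hune) x
    rwa [show S (fun x => g x (A u x)) = u from hu] at h1
  · exact hpos _ (fun x => hfnn x _ (hu0 x)) hAu x

end Cone

/-- The Ambrosetti–Rabinowitz condition with exponent above two forces superlinear growth. -/
theorem eventually_mul_le_of_ambrosetti_rabinowitz {f : ℝ → ℝ} (hf : Continuous f)
    (hnn : ∀ t, 0 ≤ t → 0 ≤ f t) {θ s₀ : ℝ} (hθ : 2 < θ) (hs₀ : 0 < s₀)
    (hAR : ∀ t, s₀ < t → θ * (∫ r in (0:ℝ)..t, f r) < f t * t) (M : ℝ) :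
    ∀ᶠ t in atTop, M * t ≤ f t := by
  let F : ℝ → ℝ := fun t => ∫ r in (0:ℝ)..t, f r
  have hF : ∀ t, HasDerivAt F (f t) t := fun t => (hf.integral_hasStrictDerivAt 0 t).hasDerivAt
  have hF0 : ∀ t, 0 ≤ t → 0 ≤ F t := fun t ht =>
    intervalIntegral.integral_nonneg ht fun x hx => hnn x hx.1
  have hfpos : ∀ t, s₀ < t → 0 < f t := fun t ht => by
    have h1 := hAR t ht
    have h2 : 0 ≤ θ * F t := mul_nonneg (by linarith) (hF0 t (by linarith))
    exact pos_of_mul_pos_left (h2.trans_lt h1) (by linarith)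
  set a := s₀ + 1
  have hsa : s₀ < a := lt_add_one s₀
  have hFa : 0 < F a := by
    have h1 : 0 < ∫ r in s₀..a, f r := intervalIntegral.intervalIntegral_pos_of_pos_on
      (hf.intervalIntegrable _ _) (fun x hx => hfpos x hx.1) hsa
    have h2 : F s₀ + ∫ r in s₀..a, f r = F a :=
      intervalIntegral.integral_add_adjacent_intervals (hf.intervalIntegrable _ _)
        (hf.intervalIntegrable _ _)
    linarith [hF0 s₀ hs₀.le]
  have hQ : ∀ t, 0 < t → HasDerivAt (fun t => F t * t ^ (-θ))
      (f t * t ^ (-θ) + F t * (-θ * t ^ (-θ - 1))) t := fun t ht =>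
    (hF t).mul (Real.hasDerivAt_rpow_const (Or.inl ht.ne'))
  have hmono : MonotoneOn (fun t => F t * t ^ (-θ)) (Ici a) := by
    refine monotoneOn_of_deriv_nonneg (convex_Ici a)
      (fun t ht => (hQ t ?_).continuousAt.continuousWithinAt)
      (fun t ht => (hQ t ?_).differentiableAt.differentiableWithinAt) fun t ht => ?_
    · exact (hs₀.trans hsa).trans_le ht
    · rw [interior_Ici] at ht
      exact (hs₀.trans hsa).trans ht
    · rw [interior_Ici] at ht
      have ht0 : 0 < t := (hs₀.trans hsa).trans ht
      rw [(hQ t ht0).deriv]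
      have h1 : t ^ (-θ) = t ^ (-θ - 1) * t := by
        rw [← Real.rpow_add_one ht0.ne']
        ring_nf
      rw [h1]
      have h2 : 0 ≤ t ^ (-θ - 1) * (f t * t - θ * F t) :=
        mul_nonneg (by positivity) (sub_nonneg.mpr (hAR t (hsa.trans ht)).le)
      linarith
  have hk : 0 < θ * (F a * a ^ (-θ)) := by
    have : 0 < a := hs₀.trans hsa
    have : 0 < θ := by linarith
    positivity
  filter_upwards [eventually_ge_atTop a, (tendsto_rpow_atTop (sub_pos.mpr hθ)).eventually_ge_atTop
    (M / (θ * (F a * a ^ (-θ))))] with t hta htM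
  have ht0 : 0 < t := (hs₀.trans hsa).trans_le hta
  rw [div_le_iff₀' hk] at htM
  have h1 : F a * a ^ (-θ) ≤ F t * t ^ (-θ) := hmono self_mem_Ici hta hta
  have h2 : F a * a ^ (-θ) * t ^ θ ≤ F t := by
    have := mul_le_mul_of_nonneg_right h1 (Real.rpow_nonneg ht0.le θ)
    rwa [mul_assoc (F t), ← Real.rpow_add ht0, neg_add_cancel, Real.rpow_zero, mul_one] at this
  have h3 : t ^ θ = t ^ (θ - 2) * (t * t) := by
    rw [← pow_two, ← Real.rpow_natCast, ← Real.rpow_add ht0]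
    norm_num
  have h4 := hAR t (hsa.trans_le hta)
  refine le_of_mul_le_mul_right ?_ ht0
  calc M * t * t ≤ θ * (F a * a ^ (-θ)) * t ^ (θ - 2) * (t * t) := by
        rw [mul_assoc M]
        exact mul_le_mul_of_nonneg_right htM (by positivity)
    _ = θ * (F a * a ^ (-θ) * t ^ θ) := by rw [h3]; ring
    _ ≤ θ * F t := mul_le_mul_of_nonneg_left h2 (by linarith)
    _ ≤ f t * t := h4.le

section Schrodinger

variable {V : Type*} [Fintype V] {w : V → V → ℝ} {h : V → ℝ}

/-- The operator `u ↦ −Δu + hu` on a finite weighted graph. -/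
def schrodingerW (w : V → V → ℝ) (h : V → ℝ) : (V → ℝ) →ₗ[ℝ] V → ℝ where
  toFun u x := -lapW w u x + h x * u x
  map_add' u v := by
    ext x
    simp only [lapW, tsum_fintype, Pi.add_apply]
    have : ∀ y, w x y * (u y + v y - (u x + v x)) =
        w x y * (u y - u x) + w x y * (v y - v x) := fun y => by ring
    simp only [this, Finset.sum_add_distrib]
    ring
  map_smul' a u := by
    ext x
    simp only [lapW, tsum_fintype, Pi.smul_apply, smul_eq_mul, RingHom.id_apply]
    have : ∀ y, w x y * (a * u y - a * u x) = a * (w x y * (u y - u x)) := fun y => by ring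
    simp only [this, ← Finset.mul_sum]
    ring

theorem schrodingerW_apply (u : V → ℝ) (x : V) :
    schrodingerW w h u x = -lapW w u x + h x * u x := rfl

theorem nonneg_of_schrodingerW_nonneg (hnn : ∀ x y, 0 ≤ w x y) (hψ : ∀ x, 0 < psiW w x)
    (hh : ∀ x, 0 < h x) {u : V → ℝ} (hu : 0 ≤ schrodingerW w h u) : 0 ≤ u := by
  intro z
  have : Nonempty V := ⟨z⟩
  obtain ⟨x, hx⟩ := Finite.exists_min u
  refine le_trans ?_ (hx z)
  by_contra! hneg
  have h1 : 0 ≤ lapW w u x := by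
    rw [lapW, tsum_fintype]
    exact mul_nonneg (inv_nonneg.mpr (hψ x).le)
      (Finset.sum_nonneg fun y _ => mul_nonneg (hnn x y) (sub_nonneg.mpr (hx y)))
  have h2 := hu x
  rw [schrodingerW_apply] at h2
  have h3 : h x * u x < 0 := mul_neg_of_pos_of_neg (hh x) hneg
  simp only [Pi.zero_apply] at h2
  linarith

theorem pos_of_schrodingerW_nonneg (hnn : ∀ x y, 0 ≤ w x y) (hψ : ∀ x, 0 < psiW w x)
    (hconn : ConnW w) (hh : ∀ x, 0 < h x) {u : V → ℝ} (hu : 0 ≤ schrodingerW w h u)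
    (hne : u ≠ 0) (x : V) : 0 < u x := by
  have hu0 := nonneg_of_schrodingerW_nonneg hnn hψ hh hu
  refine (hu0 x).lt_of_ne' fun hx => hne (funext fun y => ?_)
  induction hconn x y with
  | refl => exact hx
  | @tail b c _ hbc hb =>
    have hb : u b = 0 := hb
    have h1 := hu b
    simp only [schrodingerW_apply, lapW, tsum_fintype, hb, sub_zero, mul_zero, add_zero,
      Pi.zero_apply] at h1
    have hle : w b c * u c ≤ ∑ y, w b y * u y :=
      Finset.single_le_sum (f := fun y => w b y * u y)
        (fun y _ => mul_nonneg (hnn b y) (hu0 y)) (Finset.mem_univ c)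
    have hsum : ∑ y, w b y * u y ≤ 0 := by
      by_contra! hpos
      have := mul_pos (inv_pos.mpr (hψ b)) hpos
      linarith
    exact le_antisymm (nonpos_of_mul_nonpos_right (hle.trans hsum) hbc) (hu0 c)

theorem schrodingerW_injective (hnn : ∀ x y, 0 ≤ w x y) (hψ : ∀ x, 0 < psiW w x)
    (hh : ∀ x, 0 < h x) : Function.Injective (schrodingerW w h) := by
  refine (injective_iff_map_eq_zero _).mpr fun u hu => le_antisymm ?_ ?_
  · exact neg_nonneg.mp
      (nonneg_of_schrodingerW_nonneg hnn hψ hh (by rw [map_neg, hu, neg_zero]))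
  · exact nonneg_of_schrodingerW_nonneg hnn hψ hh hu.ge

/-- The Green operator of `−Δ + h` has a strictly positive kernel. -/
theorem exists_green_operator (hnn : ∀ x y, 0 ≤ w x y) (hψ : ∀ x, 0 < psiW w x)
    (hconn : ConnW w) (hh : ∀ x, 0 < h x) :
    ∃ S : (V → ℝ) →ₗ[ℝ] V → ℝ, (∀ k, schrodingerW w h (S k) = k) ∧
      ∃ c > 0, ∀ k, 0 ≤ k → ∀ x y, c * k y ≤ S k x := by
  classical
  let e := LinearEquiv.ofInjectiveEndo (schrodingerW w h) (schrodingerW_injective hnn hψ hh)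
  have he : ∀ k, schrodingerW w h (e.symm k) = k := fun k => e.apply_symm_apply k
  refine ⟨e.symm.toLinearMap, he, ?_⟩
  have hker : ∀ p : V × V, 0 < e.symm (Pi.single p.1 1) p.2 := fun p =>
    pos_of_schrodingerW_nonneg hnn hψ hconn hh
      (by rw [he]; exact Pi.single_nonneg.mpr zero_le_one) (by simp) p.2
  obtain ⟨c, hc, hcle⟩ : ∃ c > 0, ∀ p : V × V, c ≤ e.symm (Pi.single p.1 1) p.2 := by
    rcases isEmpty_or_nonempty (V × V) with hV | hV
    · exact ⟨1, one_pos, fun p => isEmptyElim p⟩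
    · obtain ⟨p, hp⟩ := Finite.exists_min fun p : V × V => e.symm (Pi.single p.1 1) p.2
      exact ⟨_, hker p, hp⟩
  refine ⟨c, hc, fun k hk x y => ?_⟩
  have hdiff : 0 ≤ e.symm (k - k y • Pi.single y 1) := by
    refine nonneg_of_schrodingerW_nonneg hnn hψ hh ?_
    rw [he]
    intro z
    rcases eq_or_ne z y with rfl | hz
    · simp
    · simpa [hz] using hk z
  have h1 := hdiff x
  rw [map_sub, map_smul] at h1
  simp only [Pi.zero_apply, Pi.sub_apply, Pi.smul_apply, smul_eq_mul, sub_nonneg] at h1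
  rw [mul_comm]
  exact (mul_le_mul_of_nonneg_left (hcle (y, x)) (hk y)).trans h1

end Schrodinger

end Auxiliary

/-- existence of a positive solution to a semilinear system on a finite graph. -/
theorem semilinear_system_finite_graph {V : Type*} [Fintype V] (w : V → V → ℝ)
    (hsymm : ∀ x y, w x y = w y x) (hnn : ∀ x y, 0 ≤ w x y)
    (hψ : ∀ x, 0 < psiW w x) (hconn : ConnW w)
    (h : V → ℝ) (hh : ∀ x, 0 < h x)
    (f g : V → ℝ → ℝ)
    (H1 : ∀ x, Continuous (f x) ∧ Continuous (g x) ∧ f x 0 = 0 ∧ g x 0 = 0 ∧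
      ∀ t : ℝ, 0 ≤ t → 0 ≤ f x t ∧ 0 ≤ g x t)
    (s : ℝ) (hs : 1 < s)
    (H2 : ∀ ε > 0, ∃ M > 0, ∀ x, ∀ t : ℝ, M ≤ |t| →
      |f x t| ≤ ε * |t| ^ s ∧ |g x t| ≤ ε * |t| ^ s)
    (H3 : ∀ ε > 0, ∃ δ > 0, ∀ x, ∀ t : ℝ, |t| ≤ δ →
      |f x t| ≤ ε * |t| ∧ |g x t| ≤ ε * |t|)
    (θ s₀ : ℝ) (hθ : 2 < θ) (hs₀ : 0 < s₀)
    (H4 : ∀ x, ∀ t : ℝ, s₀ < t →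
      θ * (∫ r in (0:ℝ)..t, f x r) < f x t * t ∧
      θ * (∫ r in (0:ℝ)..t, g x r) < g x t * t) :
    ∃ u v : V → ℝ, (∀ x, 0 < u x ∧ 0 < v x) ∧
      (∀ x, -lapW w u x + h x * u x = g x (v x)) ∧
      (∀ x, -lapW w v x + h x * v x = f x (u x)) := by
  rcases isEmpty_or_nonempty V with hV | hV
  · exact ⟨0, 0, isEmptyElim, isEmptyElim, isEmptyElim⟩
  obtain ⟨S, hS, c, hc, hcS⟩ := exists_green_operator hnn hψ hconn hh
  obtain ⟨u, v, hpos, hu, hv⟩ := exists_pos_solution_hammerstein_system S hc hcS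
    (fun x => (H1 x).1) (fun x => (H1 x).2.1) (fun x => (H1 x).2.2.2.1)
    (fun x t ht => ((H1 x).2.2.2.2 t ht).1) (fun x t ht => ((H1 x).2.2.2.2 t ht).2) H3
    (fun M x => eventually_mul_le_of_ambrosetti_rabinowitz (H1 x).1
      (fun t ht => ((H1 x).2.2.2.2 t ht).1) hθ hs₀ (fun t ht => (H4 x t ht).1) M)
    (fun M x => eventually_mul_le_of_ambrosetti_rabinowitz (H1 x).2.1
      (fun t ht => ((H1 x).2.2.2.2 t ht).2) hθ hs₀ (fun t ht => (H4 x t ht).2) M)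
  refine ⟨u, v, hpos, fun x => ?_, fun x => ?_⟩
  · rw [← schrodingerW_apply, hu, hS]
  · rw [← schrodingerW_apply, hv, hS]
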